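/- Let 0<ν<1 and c∈ℝ. Then for every t>0, the Caputo fractional derivative of order ν of the function f(s)=E_ν(c s^ν) satisfies (D^ν f)(t) = c E_ν(c t^ν); in particular f solves the fractional relaxation/growth equation D^ν f = c f with f(0)=1. -/

import Mathlib

open MeasureTheory

/-- The Mittag-Leffler function `E_ν(x) = ∑_{k≥0} x^k / Γ(kν+1)`. -/
noncomputable def ML (ν x : ℝ) : ℝ := ∑' k : ℕ, x ^ k / Real.Gamma ((k : ℝ) * ν + 1)

/-- The Caputo fractional derivative of order `ν ∈ (0,1)`. -/
noncomputable def caputo (ν : ℝ) (f : ℝ → ℝ) (t : ℝ) : ℝ :=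
  (1 / Real.Gamma (1 - ν)) * ∫ s in (0:ℝ)..t, deriv f s * (t - s) ^ (-ν)

lemma ml_gamma_lower (y R : ℝ) (hy : 0 ≤ y) (hR : 0 < R) :
    R ^ y * Real.exp (-R) ≤ Real.Gamma (y + 1) := by
  rw [Real.Gamma_eq_integral (by linarith)]
  have hint := Real.GammaIntegral_convergent (s := y + 1) (by linarith)
  have h1 : ∫ x in Set.Ioi R, R ^ y * Real.exp (-x) = R ^ y * Real.exp (-R) := by
    rw [integral_const_mul, integral_exp_neg_Ioi]
  rw [← h1]
  have hsub : Set.Ioi R ⊆ Set.Ioi (0:ℝ) := Set.Ioi_subset_Ioi hR.le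
  calc _ ≤ ∫ x in Set.Ioi R, Real.exp (-x) * x ^ (y + 1 - 1) := by
        apply setIntegral_mono_on ((integrableOn_exp_neg_Ioi R).const_mul _) (hint.mono_set hsub)
          measurableSet_Ioi
        intro x hx
        have hx' : R < x := hx
        rw [mul_comm, add_sub_cancel_right]
        gcongr
    _ ≤ _ := by
        apply setIntegral_mono_set hint _ hsub.eventuallyLE
        filter_upwards [ae_restrict_mem measurableSet_Ioi] with x hx
        have hx' : 0 < x := hx
        positivity

lemma ml_summable (ν : ℝ) (hν : 0 < ν) (x : ℝ) :
    Summable fun k : ℕ => x ^ k / Real.Gamma ((k : ℝ) * ν + 1) := by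
  set R : ℝ := (2 * (|x| + 1)) ^ (1 / ν) with hRdef
  have hR : 0 < R := by positivity
  have hRν : R ^ ν = 2 * (|x| + 1) := by
    rw [hRdef, ← Real.rpow_mul (by positivity), one_div, inv_mul_cancel₀ hν.ne', Real.rpow_one]
  refine Summable.of_norm_bounded (g := fun k : ℕ => Real.exp R * (1 / 2 : ℝ) ^ k)
    (summable_geometric_two.mul_left _) ?_
  intro k
  have hg := ml_gamma_lower ((k : ℝ) * ν) R (by positivity) hR
  have hGp : 0 < Real.Gamma ((k : ℝ) * ν + 1) := Real.Gamma_pos_of_pos (by positivity)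
  rw [norm_div, norm_pow, Real.norm_eq_abs, Real.norm_of_nonneg hGp.le, div_le_iff₀ hGp]
  rw [mul_comm (k : ℝ) ν, Real.rpow_mul hR.le, Real.rpow_natCast, hRν, mul_comm ν] at hg
  calc |x| ^ k ≤ (|x| + 1) ^ k := by gcongr; linarith
    _ = Real.exp R * (1 / 2) ^ k * ((2 * (|x| + 1)) ^ k * Real.exp (-R)) := by
        rw [Real.exp_neg, mul_pow, one_div, inv_pow]; field_simp
    _ ≤ _ := by gcongr

lemma ml_summable_deriv (ν : ℝ) (hν : 0 < ν) (x : ℝ) :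
    Summable fun k : ℕ => (k : ℝ) * x ^ (k - 1) / Real.Gamma ((k : ℝ) * ν + 1) := by
  refine Summable.of_norm_bounded (ml_summable ν hν (2 * (|x| + 1))) ?_
  intro k
  have hGp : 0 < Real.Gamma ((k : ℝ) * ν + 1) := Real.Gamma_pos_of_pos (by positivity)
  rw [norm_div, norm_mul, norm_pow, Real.norm_eq_abs x, Real.norm_of_nonneg hGp.le,
    Real.norm_of_nonneg (Nat.cast_nonneg k), mul_pow]
  gcongr
  · exact_mod_cast Nat.lt_two_pow_self.le
  · calc |x| ^ (k - 1) ≤ (|x| + 1) ^ (k - 1) := by gcongr; linarith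
      _ ≤ _ := pow_le_pow_right₀ (by linarith [abs_nonneg x]) (Nat.sub_le _ _)

lemma ml_hasDerivAt (ν : ℝ) (hν : 0 < ν) (x : ℝ) :
    HasDerivAt (ML ν) (∑' k : ℕ, (k : ℝ) * x ^ (k - 1) / Real.Gamma ((k : ℝ) * ν + 1)) x := by
  unfold ML
  have hx : x ∈ Set.Ioo (-(|x| + 1)) (|x| + 1) := by
    constructor <;> linarith [neg_abs_le x, le_abs_self x]
  refine hasDerivAt_tsum_of_isPreconnected (g := fun (k : ℕ) (x : ℝ) => x ^ k / Real.Gamma ((k : ℝ) * ν + 1))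
    (g' := fun (k : ℕ) (x : ℝ) => (k : ℝ) * x ^ (k - 1) / Real.Gamma ((k : ℝ) * ν + 1)) (ml_summable_deriv ν hν (|x| + 1)) isOpen_Ioo
    isPreconnected_Ioo ?_ ?_ hx (ml_summable ν hν x) hx
  · intro k y _
    exact (hasDerivAt_pow k y).div_const _
  · intro k y hy
    have hGp : 0 < Real.Gamma ((k : ℝ) * ν + 1) := Real.Gamma_pos_of_pos (by positivity)
    rw [norm_div, norm_mul, norm_pow, Real.norm_eq_abs y, Real.norm_of_nonneg hGp.le,
      Real.norm_of_nonneg (Nat.cast_nonneg k)]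
    gcongr
    exact abs_le.2 ⟨hy.1.le, hy.2.le⟩

lemma ml_beta (p q t : ℝ) (hp : 0 < p) (hq : 0 < q) (ht : 0 < t) :
    ∫ s in (0:ℝ)..t, s ^ (p - 1) * (t - s) ^ (q - 1)
      = t ^ (p + q - 1) * (Real.Gamma p * Real.Gamma q / Real.Gamma (p + q)) := by
  have h := Complex.betaIntegral_scaled p q ht
  rw [Complex.betaIntegral_eq_Gamma_mul_div _ _ (by simpa) (by simpa)] at h
  have h2 : ∫ x in (0:ℝ)..t, (x:ℂ) ^ ((p:ℂ) - 1) * ((t:ℂ) - x) ^ ((q:ℂ) - 1)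
      = ∫ x in (0:ℝ)..t, (((x ^ (p - 1) * (t - x) ^ (q - 1) : ℝ)) : ℂ) := by
    apply intervalIntegral.integral_congr
    intro x hx
    rw [Set.uIcc_of_le ht.le] at hx
    have h3 : 0 ≤ t - x := by linarith [hx.2]
    simp only
    rw [Complex.ofReal_mul, Complex.ofReal_cpow hx.1, Complex.ofReal_cpow h3]
    push_cast
    rfl
  rw [h2, intervalIntegral.integral_ofReal] at h
  apply Complex.ofReal_injective
  rw [h]
  push_cast [Complex.ofReal_cpow ht.le, ← Complex.Gamma_ofReal]
  rfl

/-- The k-th term of the integrand. -/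
noncomputable def mlTerm (ν c t : ℝ) (k : ℕ) (s : ℝ) : ℝ :=
  (c ^ (k + 1) / Real.Gamma (((k : ℝ) + 1) * ν)) *
    (s ^ (((k : ℝ) + 1) * ν - 1) * (t - s) ^ ((1 - ν) - 1))

lemma mlTerm_integral (ν c t : ℝ) (hν0 : 0 < ν) (hν1 : ν < 1) (ht : 0 < t) (k : ℕ) :
    ∫ s in (0:ℝ)..t, mlTerm ν c t k s =
      (Real.Gamma (1 - ν) * c) * ((c * t ^ ν) ^ k / Real.Gamma ((k : ℝ) * ν + 1)) := by
  unfold mlTerm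
  have hp : 0 < ((k : ℝ) + 1) * ν := by positivity
  rw [intervalIntegral.integral_const_mul, ml_beta _ _ t hp (by linarith) ht]
  have e : ((k : ℝ) + 1) * ν + (1 - ν) = k * ν + 1 := by ring
  have h1 := (Real.Gamma_pos_of_pos hp).ne'
  rw [e, add_sub_cancel_right, mul_pow, mul_comm (k : ℝ) ν, Real.rpow_mul ht.le, Real.rpow_natCast]
  field_simp
  try ring

lemma mlTerm_intervalIntegrable (ν c t : ℝ) (hν0 : 0 < ν) (hν1 : ν < 1) (ht : 0 < t) (k : ℕ) :
    IntervalIntegrable (mlTerm ν c t k) volume 0 t := by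
  unfold mlTerm
  have hp : 0 < ((k : ℝ) + 1) * ν := by positivity
  apply IntervalIntegrable.const_mul
  by_contra hcon
  have h := intervalIntegral.integral_undef hcon
  rw [ml_beta _ _ t hp (by linarith) ht] at h
  have h1 := Real.Gamma_pos_of_pos hp
  have h2 := Real.Gamma_pos_of_pos (show 0 < 1 - ν by linarith)
  have h3 := Real.Gamma_pos_of_pos (show 0 < ((k : ℝ) + 1) * ν + (1 - ν) by linarith)
  have : 0 < t ^ (((k : ℝ) + 1) * ν + (1 - ν) - 1) * (Real.Gamma (((k : ℝ) + 1) * ν) *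
    Real.Gamma (1 - ν) / Real.Gamma (((k : ℝ) + 1) * ν + (1 - ν))) := by positivity
  exact this.ne' h

lemma ml_deriv_eq (ν c t s : ℝ) (hν0 : 0 < ν) (hs : 0 < s) :
    deriv (fun s => ML ν (c * s ^ ν)) s * (t - s) ^ (-ν) = ∑' k : ℕ, mlTerm ν c t k s := by
  have hd : HasDerivAt (fun s : ℝ => c * s ^ ν) (c * (ν * s ^ (ν - 1))) s :=
    (Real.hasDerivAt_rpow_const (Or.inl hs.ne')).const_mul c
  have := (ml_hasDerivAt ν hν0 (c * s ^ ν)).comp s hd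
  have h2 : deriv (fun s => ML ν (c * s ^ ν)) s = _ := this.deriv
  rw [h2, (ml_summable_deriv ν hν0 _).tsum_eq_zero_add, mul_assoc]
  simp only [Nat.cast_zero, zero_mul, zero_div, zero_add]
  rw [← tsum_mul_right]
  apply tsum_congr
  intro k
  unfold mlTerm
  have hp : 0 < ((k : ℝ) + 1) * ν := by positivity
  have h1 := (Real.Gamma_pos_of_pos hp).ne'
  have e1 : s ^ (((k : ℝ) + 1) * ν - 1) = (s ^ ν) ^ k * s ^ (ν - 1) := by
    rw [← Real.rpow_natCast, ← Real.rpow_mul hs.le, ← Real.rpow_add hs]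
    congr 1; ring
  have e2 : (1 - ν) - 1 = -ν := by ring
  push_cast
  rw [Real.Gamma_add_one hp.ne', e1, e2, mul_pow]
  have : (k : ℝ) + 1 ≠ 0 := by positivity
  field_simp
  try ring

/-- The Mittag-Leffler function solves the fractional relaxation/growth equation:
`D^ν (E_ν(c ·^ν)) (t) = c E_ν(c t^ν)`, with initial value `1` at `t = 0`. -/
theorem caputo_mittagLeffler (ν c : ℝ) (hν0 : 0 < ν) (hν1 : ν < 1) (t : ℝ) (ht : 0 < t) :
    caputo ν (fun s => ML ν (c * s ^ ν)) t = c * ML ν (c * t ^ ν) ∧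
    ML ν (c * (0 : ℝ) ^ ν) = 1 := by
  constructor
  · have hG := (Real.Gamma_pos_of_pos (show 0 < 1 - ν by linarith)).ne'
    have hI : ∫ s in (0:ℝ)..t, deriv (fun s => ML ν (c * s ^ ν)) s * (t - s) ^ (-ν)
        = ∑' k : ℕ, ∫ s in (0:ℝ)..t, mlTerm ν c t k s := by
      simp only [intervalIntegral.integral_of_le ht.le]
      have hs : HasSum (fun k => ∫ s in Set.Ioc 0 t, mlTerm ν c t k s)
          (∫ s in Set.Ioc 0 t, ∑' k : ℕ, mlTerm ν c t k s) := by
        apply hasSum_integral_of_summable_integral_norm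
        · intro k
          exact (intervalIntegrable_iff_integrableOn_Ioc_of_le ht.le).1
            (mlTerm_intervalIntegrable ν c t hν0 hν1 ht k)
        · have := (ml_summable ν hν0 (|c| * t ^ ν)).mul_left (Real.Gamma (1 - ν) * |c|)
          refine this.congr ?_
          intro k
          rw [← mlTerm_integral ν |c| t hν0 hν1 ht k, intervalIntegral.integral_of_le ht.le]
          apply setIntegral_congr_fun measurableSet_Ioc
          intro s hs
          have hp : 0 < ((k : ℝ) + 1) * ν := by positivity
          have h1 := (Real.Gamma_pos_of_pos hp)
          have h2 : 0 ≤ s ^ (((k : ℝ) + 1) * ν - 1) := Real.rpow_nonneg hs.1.le _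
          have h3 : 0 ≤ (t - s) ^ ((1 - ν) - 1) := Real.rpow_nonneg (by linarith [hs.2]) _
          simp only [mlTerm]
          rw [norm_mul, norm_div, norm_pow, Real.norm_eq_abs c, Real.norm_of_nonneg h1.le,
            Real.norm_of_nonneg (mul_nonneg h2 h3)]
      rw [hs.tsum_eq]
      apply setIntegral_congr_fun measurableSet_Ioc
      intro s hs
      exact ml_deriv_eq ν c t s hν0 hs.1
    unfold caputo
    rw [hI]
    simp only [mlTerm_integral ν c t hν0 hν1 ht]
    rw [tsum_mul_left, ML]
    field_simp
  · rw [Real.zero_rpow hν0.ne', mul_zero, ML, tsum_eq_single 0]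
    · simp
    · intro k hk
      simp [hk]
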